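/- Let F ∈ 𝔉, let u ∈ W¹₁(-1,1) be nonnegative with u(-1) = u(1) = 0, and let the weight a : [-1,1] × [0,∞) → [0,∞) be continuous and, for every v ≥ 0, even and convex with respect to the first argument (a(-x,v) = a(x,v) and x ↦ a(x,v) is convex on [-1,1]). Then I(a,ū) ≤ I(a,u). -/

import Mathlib

open MeasureTheory Set Filter
open scoped ENNReal BigOperators NNReal

noncomputable section

/-- `u ∈ W¹₁(-1,1)`: `u` is absolutely continuous on `[-1,1]` with (a.e.) derivative in `L¹`,
encoded via the fundamental theorem of calculus with the pointwise derivative `deriv u`. -/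
def MemW11 (u : ℝ → ℝ) : Prop :=
  IntegrableOn (deriv u) (Icc (-1 : ℝ) 1) volume ∧
  ∀ x ∈ Icc (-1 : ℝ) 1, u x = u (-1) + ∫ t in (-1 : ℝ)..x, deriv u t

/-- Convergence `u_k → u` in `W¹₁(-1,1)`. -/
def W11Tendsto (uk : ℕ → ℝ → ℝ) (u : ℝ → ℝ) : Prop :=
  Tendsto (fun k => ∫ x in Icc (-1 : ℝ) 1, (|uk k x - u x| + |deriv (uk k) x - deriv u x|))
    atTop (nhds 0)

/-- `F ∈ 𝔉`: continuous, nonnegative, convex and nondecreasing in the second argument. -/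
def MemFrakF (F : ℝ → ℝ → ℝ) : Prop :=
  ContinuousOn (fun p : ℝ × ℝ => F p.1 p.2) (Ici (0 : ℝ) ×ˢ Ici (0 : ℝ)) ∧
  (∀ v p : ℝ, 0 ≤ v → 0 ≤ p → 0 ≤ F v p) ∧
  (∀ v : ℝ, 0 ≤ v → ConvexOn ℝ (Ici (0 : ℝ)) (F v)) ∧
  (∀ v : ℝ, 0 ≤ v → MonotoneOn (F v) (Ici (0 : ℝ)))

/-- A continuous nonnegative weight on `[-1,1] × [0,∞)`. -/
def Weight (a : ℝ → ℝ → ℝ) : Prop :=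
  ContinuousOn (fun p : ℝ × ℝ => a p.1 p.2) (Icc (-1 : ℝ) 1 ×ˢ Ici (0 : ℝ)) ∧
  ∀ x v : ℝ, x ∈ Icc (-1 : ℝ) 1 → 0 ≤ v → 0 ≤ a x v

/-- Condition (C): `a(s,v) + a(t,v) ≥ a(1 - t + s, v)` for `-1 ≤ s ≤ t ≤ 1`, `v ≥ 0`. -/
def CondC (a : ℝ → ℝ → ℝ) : Prop :=
  ∀ s t v : ℝ, -1 ≤ s → s ≤ t → t ≤ 1 → 0 ≤ v → a (1 - t + s) v ≤ a s v + a t v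

/-- Condition (C) for a one-variable weight. -/
def CondC1 (a : ℝ → ℝ) : Prop :=
  ∀ s t : ℝ, -1 ≤ s → s ≤ t → t ≤ 1 → a (1 - t + s) ≤ a s + a t

/-- Condition (C'): `a(s,v) + a(t,v) ≥ a((s-t)/2, v) + a((t-s)/2, v)`. -/
def CondC' (a : ℝ → ℝ → ℝ) : Prop :=
  ∀ s t v : ℝ, s ∈ Icc (-1 : ℝ) 1 → t ∈ Icc (-1 : ℝ) 1 → 0 ≤ v →
    a ((s - t) / 2) v + a ((t - s) / 2) v ≤ a s v + a t v

/-- The functional `I(a,u) = ∫_{-1}^1 F(u(x), a(x,u(x))·|u'(x)|) dx ∈ [0,∞]`. -/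
def Ifun (F a : ℝ → ℝ → ℝ) (u : ℝ → ℝ) : ℝ≥0∞ :=
  ∫⁻ x in Icc (-1 : ℝ) 1, ENNReal.ofReal (F (u x) (a x (u x) * |deriv u x|))

/-- The monotone rearrangement `u*(x) = ∫₀^∞ χ_{[1-|A_t|,1]}(x) dt`,
where `A_t = {y ∈ [-1,1] : u(y) > t}`. -/
def mrear (u : ℝ → ℝ) (x : ℝ) : ℝ :=
  ∫ t in Ioi (0 : ℝ),
    (Icc (1 - (volume {y ∈ Icc (-1 : ℝ) 1 | u y > t}).toReal) 1).indicator
      (fun _ => (1 : ℝ)) x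

/-- The symmetric rearrangement `ū(x) = ∫₀^∞ χ_{[-|A_t|/2, |A_t|/2]}(x) dt`. -/
def srear (u : ℝ → ℝ) (x : ℝ) : ℝ :=
  ∫ t in Ioi (0 : ℝ),
    (Icc (-((volume {y ∈ Icc (-1 : ℝ) 1 | u y > t}).toReal / 2))
        ((volume {y ∈ Icc (-1 : ℝ) 1 | u y > t}).toReal / 2)).indicator
      (fun _ => (1 : ℝ)) x

/-- `u` is piecewise linear on `[-1,1]`: there is a partition `-1 = x₀ < ⋯ < x_n = 1`
such that `u` is affine on each `[x_i, x_{i+1}]`. -/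
def PiecewiseLinear (u : ℝ → ℝ) : Prop :=
  ∃ n : ℕ, ∃ x : Fin (n + 1) → ℝ, x 0 = -1 ∧ x (Fin.last n) = 1 ∧ StrictMono x ∧
    ∀ i : Fin n, ∃ c d : ℝ, ∀ y ∈ Icc (x i.castSucc) (x i.succ), u y = c * y + d

/-- The Lusin (N) property of primitives of integrable functions. -/
theorem volume_image_eq_zero_of_primitive {w u : ℝ → ℝ} (hw : Integrable w)
    (hu : ∀ x, u x = ∫ t in (-1 : ℝ)..x, w t) {N : Set ℝ} (hN : volume N = 0) :
    volume (u '' N) = 0 := by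
  have hi : ∀ a b : ℝ, IntervalIntegrable w volume a b := fun a b => hw.intervalIntegrable
  have hi' : ∀ a b : ℝ, IntervalIntegrable (fun t => |w t|) volume a b :=
    fun a b => hw.abs.intervalIntegrable
  have hsub : ∀ x y : ℝ, (∫ t in (-1 : ℝ)..y, |w t|) - (∫ t in (-1 : ℝ)..x, |w t|)
      = ∫ t in x..y, |w t| := fun x y =>
    intervalIntegral.integral_interval_sub_left (hi' _ _) (hi' _ _)
  let g : StieltjesFunction ℝ :=
    { toFun := fun x => ∫ t in (-1 : ℝ)..x, |w t|
      mono' := fun x y hxy => by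
        have := intervalIntegral.integral_nonneg hxy (fun t _ => abs_nonneg (w t)) (μ := volume)
        have h2 := hsub x y
        linarith
      right_continuous' := fun x =>
        (intervalIntegral.continuous_primitive (fun a b => hi' a b) (-1)).continuousWithinAt }
  have hg : ∀ x y : ℝ, g y - g x = ∫ t in x..y, |w t| := hsub
  have hmeas : g.measure = volume.withDensity (fun t => ‖w t‖ₑ) := by
    refine Measure.ext_of_Ioc _ _ fun a b hab => ?_
    rw [StieltjesFunction.measure_Ioc, withDensity_apply _ measurableSet_Ioc, hg,
      intervalIntegral.integral_of_le hab.le,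
      ofReal_integral_eq_lintegral_ofReal hw.abs.integrableOn
        (Eventually.of_forall fun t => abs_nonneg _)]
    simp only [← Real.norm_eq_abs, ofReal_norm]
  have hle : OuterMeasure.comap u volume.toOuterMeasure ≤ g.outer := by
    refine OuterMeasure.le_ofFunction.2 fun s => ?_
    rw [OuterMeasure.comap_apply]
    rw [StieltjesFunction.length_eq]
    refine le_iInf fun a => le_iInf fun b => le_iInf fun hs => ?_
    replace hs : s ⊆ Ioc a b := fun x hx => hs ⟨hx, not_isBot x⟩
    refine (Real.volume_le_diam _).trans (Metric.ediam_le ?_)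
    rintro _ ⟨x, hx, rfl⟩ _ ⟨y, hy, rfl⟩
    have key : ∀ x ∈ Ioc a b, ∀ y ∈ Ioc a b, x ≤ y → |u y - u x| ≤ g b - g a := by
      intro x hx y hy hxy
      rw [hu, hu, intervalIntegral.integral_interval_sub_left (hi _ _) (hi _ _)]
      refine (intervalIntegral.abs_integral_le_integral_abs hxy).trans ?_
      rw [← hg]
      have := g.mono hx.1.le
      have := g.mono hy.2
      linarith
    rw [edist_dist, Real.dist_eq]
    refine ENNReal.ofReal_le_ofReal ?_
    rcases le_total x y with h | h
    · rw [abs_sub_comm]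
      exact key x (hs hx) y (hs hy) h
    · exact key y (hs hy) x (hs hx) h
  have h0 : g.measure N = 0 := by
    rw [hmeas]
    exact withDensity_absolutelyContinuous _ _ hN
  refine le_antisymm ((hle N).trans (le_of_eq ?_)) zero_le
  rwa [StieltjesFunction.measure] at h0

/-- The distribution function of `u` on `[-1,1]`. -/
def distr (u : ℝ → ℝ) (t : ℝ) : ℝ :=
  (volume {y ∈ Icc (-1 : ℝ) 1 | u y > t}).toReal

theorem volume_superlevel_ne_top (u : ℝ → ℝ) (t : ℝ) :
    volume {y ∈ Icc (-1 : ℝ) 1 | u y > t} ≠ ∞ :=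
  measure_ne_top_of_subset (sep_subset _ _) measure_Icc_lt_top.ne

theorem distr_nonneg (u : ℝ → ℝ) (t : ℝ) : 0 ≤ distr u t := ENNReal.toReal_nonneg

theorem ofReal_distr (u : ℝ → ℝ) (t : ℝ) :
    ENNReal.ofReal (distr u t) = volume {y ∈ Icc (-1 : ℝ) 1 | u y > t} :=
  ENNReal.ofReal_toReal (volume_superlevel_ne_top u t)

theorem distr_le_of_subset {u : ℝ → ℝ} {t a b : ℝ} (hab : a ≤ b)
    (h : ∀ y ∈ Icc (-1 : ℝ) 1, t < u y → y ∈ Icc a b) : distr u t ≤ b - a := by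
  refine ENNReal.toReal_le_of_le_ofReal (by linarith) ?_
  rw [← Real.volume_Icc]
  exact measure_mono fun y hy => h y hy.1 hy.2

theorem distr_le_two (u : ℝ → ℝ) (t : ℝ) : distr u t ≤ 2 := by
  have := distr_le_of_subset (u := u) (t := t) (a := -1) (b := 1) (by norm_num) fun y hy _ => hy
  linarith

theorem distr_antitone (u : ℝ → ℝ) : Antitone (distr u) := fun _ _ hst =>
  ENNReal.toReal_mono (volume_superlevel_ne_top u _)
    (measure_mono fun _ hy => ⟨hy.1, lt_of_le_of_lt hst hy.2⟩)

theorem distr_eq_zero {u : ℝ → ℝ} {M t : ℝ} (hM : ∀ y ∈ Icc (-1 : ℝ) 1, u y ≤ M) (ht : M ≤ t) :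
    distr u t = 0 := by
  have : {y ∈ Icc (-1 : ℝ) 1 | u y > t} = ∅ :=
    eq_empty_of_forall_notMem fun y hy => absurd hy.2 (not_lt.2 ((hM y hy.1).trans ht))
  simp only [distr, this, measure_empty, ENNReal.toReal_zero]

theorem exists_lt_distr {u : ℝ → ℝ} {t c : ℝ} (hc : 0 ≤ c) (h : c < distr u t) :
    ∃ s, t < s ∧ c < distr u s := by
  have hU : {y ∈ Icc (-1 : ℝ) 1 | u y > t}
      = ⋃ n : ℕ, {y ∈ Icc (-1 : ℝ) 1 | u y > t + 1 / ((n : ℝ) + 1)} := by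
    ext y
    simp only [mem_ofPred_eq, mem_iUnion]
    constructor
    · rintro ⟨hy, hyt⟩
      obtain ⟨n, hn⟩ := exists_nat_one_div_lt (sub_pos.2 hyt)
      exact ⟨n, hy, by linarith⟩
    · rintro ⟨n, hy, hyt⟩
      have : (0 : ℝ) < 1 / ((n : ℝ) + 1) := by positivity
      exact ⟨hy, by linarith⟩
  have hmono : Monotone fun n : ℕ => {y ∈ Icc (-1 : ℝ) 1 | u y > t + 1 / ((n : ℝ) + 1)} := by
    intro n k hnk y hy
    refine ⟨hy.1, lt_of_le_of_lt ?_ hy.2⟩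
    gcongr
  have h1 := (ENNReal.ofReal_lt_iff_lt_toReal hc (volume_superlevel_ne_top u t)).2 h
  rw [hU, hmono.measure_iUnion, lt_iSup_iff] at h1
  obtain ⟨n, hn⟩ := h1
  refine ⟨t + 1 / ((n : ℝ) + 1), by have : (0 : ℝ) < 1 / ((n : ℝ) + 1) := by positivity
                                    linarith, ?_⟩
  exact (ENNReal.ofReal_lt_iff_lt_toReal hc (volume_superlevel_ne_top u _)).1 hn

theorem srear_neg (u : ℝ → ℝ) (x : ℝ) : srear u (-x) = srear u x := by
  unfold srear
  refine integral_congr_ae (Eventually.of_forall fun t => ?_)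
  simp only [indicator, mem_Icc]
  congr 1
  exact propext ⟨fun h => ⟨by linarith [h.2], by linarith [h.1]⟩,
    fun h => ⟨by linarith [h.2], by linarith [h.1]⟩⟩

theorem srear_nonneg (u : ℝ → ℝ) (x : ℝ) : 0 ≤ srear u x :=
  integral_nonneg fun _ => indicator_nonneg (fun _ _ => zero_le_one) _

theorem srear_eq (u : ℝ → ℝ) (x : ℝ) :
    srear u x = volume.real {t | 0 < t ∧ 2 * |x| ≤ distr u t} := by
  have hS : MeasurableSet {t | 2 * |x| ≤ distr u t} :=
    measurableSet_le measurable_const (distr_antitone u).measurable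
  have : srear u x
      = ∫ t in Ioi (0 : ℝ), {t | 2 * |x| ≤ distr u t}.indicator (fun _ => (1 : ℝ)) t := by
    unfold srear
    refine integral_congr_ae (Eventually.of_forall fun t => ?_)
    simp only [indicator, mem_Icc, mem_ofPred_eq, distr]
    congr 1
    rw [← abs_le]
    exact propext ⟨fun h => by linarith, fun h => by linarith⟩
  rw [this, integral_indicator hS, Measure.restrict_restrict hS, setIntegral_const, smul_eq_mul,
    mul_one]
  congr 1
  ext t
  simp [and_comm]

theorem le_distr_of_lt_srear {u : ℝ → ℝ} {x t : ℝ} (ht : 0 ≤ t) (h : t < srear u x) :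
    2 * |x| ≤ distr u t := by
  by_contra! hlt
  refine absurd h (not_lt.2 ?_)
  rw [srear_eq]
  refine ENNReal.toReal_le_of_le_ofReal ht ?_
  have h0 : ENNReal.ofReal t = volume (Ioc 0 t) := by rw [Real.volume_Ioc, sub_zero]
  rw [h0]
  refine measure_mono fun s hs => ⟨hs.1, ?_⟩
  by_contra! hst
  linarith [distr_antitone u hst.le, hs.2]

theorem lt_srear_of_lt_distr {u : ℝ → ℝ} {M x t : ℝ} (hM : ∀ y ∈ Icc (-1 : ℝ) 1, u y ≤ M)
    (hx : x ≠ 0) (ht : 0 ≤ t) (h : 2 * |x| < distr u t) : t < srear u x := by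
  obtain ⟨s, hts, hs⟩ := exists_lt_distr (by positivity) h
  refine lt_of_lt_of_le hts ?_
  rw [srear_eq]
  have hfin : volume {t | 0 < t ∧ 2 * |x| ≤ distr u t} ≠ ∞ := by
    refine measure_ne_top_of_subset (s := Ioc 0 M) (fun τ hτ => ⟨hτ.1, ?_⟩) measure_Ioc_lt_top.ne
    by_contra! hlt
    have := distr_eq_zero hM hlt.le
    have := abs_pos.2 hx
    linarith [hτ.2]
  calc s = volume.real (Ioc 0 s) := by simp [ht.trans hts.le]
    _ ≤ _ := measureReal_mono (fun τ hτ => ?_) hfin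
  exact ⟨hτ.1, hs.le.trans (distr_antitone u hτ.2)⟩

theorem srear_antitoneOn {u : ℝ → ℝ} {M : ℝ} (hM : ∀ y ∈ Icc (-1 : ℝ) 1, u y ≤ M) :
    AntitoneOn (srear u) (Ioi 0) := by
  intro x hx y hy hxy
  rcases hxy.eq_or_lt with rfl | hlt
  · exact le_rfl
  by_contra! h
  have h1 := le_distr_of_lt_srear (srear_nonneg u x) h
  rw [abs_of_pos hy] at h1
  exact lt_irrefl _ (lt_srear_of_lt_distr hM (ne_of_gt hx) (srear_nonneg u x)
    (by rw [abs_of_pos hx]; linarith))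

theorem distr_srear_le {u : ℝ → ℝ} {M x : ℝ} (hM : ∀ y ∈ Icc (-1 : ℝ) 1, u y ≤ M) (hx : 0 < x) :
    distr u (srear u x) ≤ 2 * x := by
  by_contra! h
  exact lt_irrefl _ (lt_srear_of_lt_distr hM hx.ne' (srear_nonneg u x)
    (by rwa [abs_of_pos hx]))

theorem srear_le {u : ℝ → ℝ} {M x : ℝ} (hM : ∀ y ∈ Icc (-1 : ℝ) 1, u y ≤ M) (hM0 : 0 ≤ M)
    (hx : 0 < x) : srear u x ≤ M := by
  by_contra! h
  have h1 := le_distr_of_lt_srear hM0 h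
  rw [distr_eq_zero hM le_rfl, abs_of_pos hx] at h1
  linarith

theorem deriv_eq_zero_of_const_right {f : ℝ → ℝ} {r x t : ℝ} (hrx : r < x)
    (h : ∀ y ∈ Ioo r x, f y = t) : deriv f r = 0 := by
  by_cases hd : DifferentiableAt ℝ f r
  · have hev : f =ᶠ[nhdsWithin r (Ioi r)] fun _ => t :=
      eventually_of_mem (Ioo_mem_nhdsGT hrx) h
    have ht : f r = t := by
      have h1 := hd.continuousAt.tendsto.mono_left (nhdsWithin_le_nhds (s := Ioi r))
      exact tendsto_nhds_unique (h1.congr' hev) tendsto_const_nhds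
    have h2 : HasDerivWithinAt f 0 (Ioi r) r :=
      (hasDerivWithinAt_const r (Ioi r) t).congr_of_eventuallyEq hev ht
    exact (uniqueDiffWithinAt_Ioi r).eq_deriv _ hd.hasDerivAt.hasDerivWithinAt h2
  · exact deriv_zero_of_not_differentiableAt hd

theorem deriv_eq_zero_of_const_left {f : ℝ → ℝ} {r x t : ℝ} (hrx : x < r)
    (h : ∀ y ∈ Ioo x r, f y = t) : deriv f r = 0 := by
  have h1 := deriv_eq_zero_of_const_right (f := fun y => f (-y)) (r := -r) (x := -x) (t := t)
    (by linarith) fun y hy => h (-y) ⟨by linarith [hy.2], by linarith [hy.1]⟩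
  simpa [deriv_comp_neg] using h1

/-- Where `srear u` has a nonzero derivative, its level determines the point. -/
theorem distr_srear_eq {u : ℝ → ℝ} {M x : ℝ} (hM : ∀ y ∈ Icc (-1 : ℝ) 1, u y ≤ M) (hx : 0 < x)
    (hd : deriv (srear u) x ≠ 0) : distr u (srear u x) = 2 * x := by
  refine le_antisymm (distr_srear_le hM hx) ?_
  by_contra! hlt
  have hr := distr_nonneg u (srear u x)
  refine hd (deriv_eq_zero_of_const_left (x := distr u (srear u x) / 2) (t := srear u x)
    (by linarith) fun y hy => ?_)
  have hy0 : 0 < y := by linarith [hy.1]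
  refine le_antisymm ?_ (srear_antitoneOn hM hy0 hx hy.2.le)
  by_contra! h
  have h1 := le_distr_of_lt_srear (srear_nonneg u x) h
  rw [abs_of_pos hy0] at h1
  linarith [hy.1]

theorem abs_deriv_srear {u : ℝ → ℝ} {M x : ℝ} (hM : ∀ y ∈ Icc (-1 : ℝ) 1, u y ≤ M) (hx : 0 < x)
    (k : ℝ → ℝ) :
    k (distr u (srear u x) / 2) * |deriv (srear u) (distr u (srear u x) / 2)|
      = k x * |deriv (srear u) x| := by
  by_cases hd : deriv (srear u) x = 0
  · rcases (distr_srear_le hM hx).eq_or_lt with h | h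
    · rw [h, mul_div_cancel_left₀ _ two_ne_zero]
    · have hr := distr_nonneg u (srear u x)
      have : deriv (srear u) (distr u (srear u x) / 2) = 0 := by
        refine deriv_eq_zero_of_const_right (x := x) (t := srear u x) (by linarith) fun y hy => ?_
        have hy0 : 0 < y := by linarith [hy.1]
        refine le_antisymm ?_ (srear_antitoneOn hM hy0 hx hy.2.le)
        by_contra! h
        have h1 := le_distr_of_lt_srear (srear_nonneg u x) h
        rw [abs_of_pos hy0] at h1
        linarith [hy.1]
      rw [this, hd, abs_zero, mul_zero, mul_zero]
  · rw [distr_srear_eq hM hx hd, mul_div_cancel_left₀ _ two_ne_zero]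

theorem setLIntegral_comp_neg (f : ℝ → ℝ≥0∞) (s : Set ℝ) :
    ∫⁻ x in Neg.neg ⁻¹' s, f (-x) = ∫⁻ x in s, f x :=
  (Measure.measurePreserving_neg volume).setLIntegral_comp_preimage_emb
    (MeasurableEquiv.neg ℝ).measurableEmbedding f s

theorem setLIntegral_Icc_of_even {f : ℝ → ℝ≥0∞} (hf : ∀ x, f (-x) = f x) :
    ∫⁻ x in Icc (-1 : ℝ) 1, f x = 2 * ∫⁻ x in Ioo (0 : ℝ) 1, f x := by
  have h1 : (Icc (-1 : ℝ) 1) = Ico (-1) 0 ∪ Icc 0 1 :=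
    (Ico_union_Icc_eq_Icc (by norm_num) (by norm_num)).symm
  have h2 : ∫⁻ x in Ioo (-1 : ℝ) 0, f x = ∫⁻ x in Ioo (0 : ℝ) 1, f x := by
    have := setLIntegral_comp_neg f (Ioo 0 1)
    simpa [hf] using this
  have hd : Disjoint (Ico (-1 : ℝ) 0) (Icc 0 1) :=
    disjoint_left.2 fun x hx hy => not_le.2 hx.2 hy.1
  rw [h1, lintegral_union measurableSet_Icc hd, setLIntegral_congr Ico_ae_eq_Ioc,
    setLIntegral_congr Ioo_ae_eq_Ioc.symm, setLIntegral_congr Ioo_ae_eq_Icc.symm, h2, two_mul]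

theorem volume_lt_srear {u : ℝ → ℝ} {M t : ℝ} (hM : ∀ y ∈ Icc (-1 : ℝ) 1, u y ≤ M) (ht : 0 ≤ t) :
    volume ({x | t < srear u x} ∩ Ioo 0 1) = ENNReal.ofReal (distr u t / 2) := by
  refine le_antisymm ?_ ?_
  · have : ENNReal.ofReal (distr u t / 2) = volume (Ioc 0 (distr u t / 2)) := by
      rw [Real.volume_Ioc, sub_zero]
    rw [this]
    refine measure_mono fun x hx => ⟨hx.2.1, ?_⟩
    have h1 := le_distr_of_lt_srear ht hx.1
    rw [abs_of_pos hx.2.1] at h1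
    linarith
  · have : ENNReal.ofReal (distr u t / 2) = volume (Ioo 0 (distr u t / 2)) := by
      rw [Real.volume_Ioo, sub_zero]
    rw [this]
    have h2 := distr_le_two u t
    refine measure_mono fun x hx => ⟨lt_srear_of_lt_distr hM hx.1.ne' ht ?_, hx.1, ?_⟩
    · rw [abs_of_pos hx.1]; linarith [hx.2]
    · linarith [hx.2]

/-- `u` and its symmetric rearrangement are equimeasurable. -/
theorem lintegral_comp_srear {u : ℝ → ℝ} {M : ℝ} (hu : Continuous u) (hnn : ∀ x, 0 ≤ u x)
    (hM : ∀ y ∈ Icc (-1 : ℝ) 1, u y ≤ M) {h : ℝ → ℝ≥0∞} (hh : Measurable h) :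
    ∫⁻ x in Icc (-1 : ℝ) 1, h (u x) = 2 * ∫⁻ x in Ioo (0 : ℝ) 1, h (srear u x) := by
  have hvm : AEMeasurable (srear u) (volume.restrict (Ioo 0 1)) :=
    aemeasurable_restrict_of_antitoneOn measurableSet_Ioo
      ((srear_antitoneOn hM).mono Ioo_subset_Ioi_self)
  have key : ∀ t : ℝ, (volume.restrict (Icc (-1 : ℝ) 1)).map u (Ioi t)
      = (2 • (volume.restrict (Ioo (0 : ℝ) 1)).map (srear u)) (Ioi t) := by
    intro t
    rw [Measure.map_apply hu.measurable measurableSet_Ioi, Measure.smul_apply,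
      Measure.map_apply_of_aemeasurable hvm measurableSet_Ioi,
      Measure.restrict_apply' measurableSet_Icc, Measure.restrict_apply' measurableSet_Ioo]
    rcases le_or_gt 0 t with ht | ht
    · have h1 := volume_lt_srear hM ht
      have h2 : (srear u ⁻¹' Ioi t ∩ Ioo 0 1) = {x | t < srear u x} ∩ Ioo 0 1 := rfl
      have h3 : (u ⁻¹' Ioi t ∩ Icc (-1) 1) = {y ∈ Icc (-1 : ℝ) 1 | u y > t} := by
        ext y; simp [and_comm]
      rw [h2, h1, h3, ← ofReal_distr, nsmul_eq_mul, ← ENNReal.ofReal_natCast,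
        ← ENNReal.ofReal_mul (by positivity)]
      congr 1
      push_cast
      ring
    · have h2 : (srear u ⁻¹' Ioi t ∩ Ioo 0 1) = Ioo 0 1 :=
        inter_eq_right.2 fun x _ => lt_of_lt_of_le ht (srear_nonneg u x)
      have h3 : (u ⁻¹' Ioi t ∩ Icc (-1) 1) = Icc (-1) 1 :=
        inter_eq_right.2 fun x _ => lt_of_lt_of_le ht (hnn x)
      rw [h2, h3, Real.volume_Icc, Real.volume_Ioo]
      norm_num
  have hmap : (volume.restrict (Icc (-1 : ℝ) 1)).map u
      = 2 • (volume.restrict (Ioo (0 : ℝ) 1)).map (srear u) := by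
    refine Measure.ext_of_Iic _ _ fun t => ?_
    have huniv : (volume.restrict (Icc (-1 : ℝ) 1)).map u univ
        = (2 • (volume.restrict (Ioo (0 : ℝ) 1)).map (srear u)) univ := by
      rw [Measure.map_apply hu.measurable MeasurableSet.univ, Measure.smul_apply,
        Measure.map_apply_of_aemeasurable hvm MeasurableSet.univ]
      simp
      norm_num
    rw [← compl_Ioi, measure_compl measurableSet_Ioi (measure_ne_top _ _),
      measure_compl measurableSet_Ioi (by rw [← key]; exact measure_ne_top _ _), key, huniv]
  rw [← lintegral_map hh hu.measurable, hmap, lintegral_smul_measure,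
    lintegral_map' hh.aemeasurable hvm]
  simp

/-- The first time `u` reaches the level `t` on `[-1,1]`. -/
def firstHit (u : ℝ → ℝ) (t : ℝ) : ℝ := sInf ({x ∈ Icc (-1 : ℝ) 1 | t ≤ u x} ∪ {1})

theorem bddBelow_hit (u : ℝ → ℝ) (t : ℝ) :
    BddBelow ({x ∈ Icc (-1 : ℝ) 1 | t ≤ u x} ∪ {1}) := by
  refine ⟨-1, ?_⟩
  rintro x (hx | rfl)
  · exact hx.1.1
  · norm_num

theorem firstHit_mono (u : ℝ → ℝ) : Monotone (firstHit u) := fun s _ hst =>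
  csInf_le_csInf (bddBelow_hit u s) ⟨1, Or.inr rfl⟩
    (union_subset_union_left _ fun _ hx => ⟨hx.1, hst.trans hx.2⟩)

theorem firstHit_le {u : ℝ → ℝ} {t y : ℝ} (hy : y ∈ Icc (-1 : ℝ) 1) (h : t ≤ u y) :
    firstHit u t ≤ y :=
  csInf_le (bddBelow_hit u t) (Or.inl ⟨hy, h⟩)

theorem firstHit_spec {u : ℝ → ℝ} (hu : Continuous u) (h0 : ∀ x ∉ Ioo (-1 : ℝ) 1, u x = 0)
    {t x₀ : ℝ} (ht : 0 < t) (hx₀ : t ≤ u x₀) :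
    firstHit u t ∈ Ioo (-1 : ℝ) 1 ∧ u (firstHit u t) = t ∧
      ∀ y ∈ Ico (-1 : ℝ) (firstHit u t), u y < t := by
  have hIoo : ∀ x, t ≤ u x → x ∈ Ioo (-1 : ℝ) 1 := by
    intro x hx
    by_contra h
    linarith [h0 x h]
  set l := firstHit u t with hl
  have hl1 : l < 1 :=
    (firstHit_le (Ioo_subset_Icc_self (hIoo x₀ hx₀)) hx₀).trans_lt (hIoo x₀ hx₀).2
  have hcl : IsClosed ({x ∈ Icc (-1 : ℝ) 1 | t ≤ u x} ∪ {1}) := by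
    refine IsClosed.union ?_ isClosed_singleton
    exact isClosed_Icc.inter (isClosed_le continuous_const hu)
  have hmem : t ≤ u l := by
    rcases hcl.csInf_mem ⟨1, Or.inr rfl⟩ (bddBelow_hit u t) with h | h
    · exact h.2
    · exact absurd h hl1.ne
  have hbelow : ∀ y ∈ Ico (-1 : ℝ) l, u y < t := by
    intro y hy
    by_contra! h
    exact not_le.2 hy.2 (firstHit_le ⟨hy.1, (hy.2.trans hl1).le⟩ h)
  refine ⟨hIoo l hmem, le_antisymm ?_ hmem, hbelow⟩
  have hlt := (hIoo l hmem).1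
  have hev : ∀ᶠ y in nhdsWithin l (Iio l), u y ≤ t :=
    eventually_of_mem (Ioo_mem_nhdsLT hlt) fun y hy => (hbelow y ⟨hy.1.le, hy.2⟩).le
  exact le_of_tendsto (hu.continuousAt.tendsto.mono_left nhdsWithin_le_nhds) hev

/-- Change of variables along the strict records of `u` from the left. -/
theorem exists_records {w u : ℝ → ℝ} (hw : Integrable w)
    (hu : ∀ x, u x = ∫ t in (-1 : ℝ)..x, w t) (huc : Continuous u)
    (h0 : ∀ x ∉ Ioo (-1 : ℝ) 1, u x = 0) (x₀ : ℝ) :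
    ∃ L : Set ℝ, MeasurableSet L ∧ L ⊆ Icc (-1) 1 ∧
      (∀ x ∈ L, ∀ y ∈ Ico (-1 : ℝ) x, u y < u x) ∧
      ∀ k : ℝ → ℝ → ℝ≥0∞, ∫⁻ t in Ioo 0 (u x₀), k (firstHit u t) t
        ≤ ∫⁻ x in L, ENNReal.ofReal |deriv u x| * k x (u x) := by
  have hspec := fun t (ht : t ∈ Ioo 0 (u x₀)) => firstHit_spec huc h0 ht.1 ht.2.le
  have hinj : InjOn (firstHit u) (Ioo 0 (u x₀)) := fun s hs t ht hst => by
    rw [← (hspec s hs).2.1, hst, (hspec t ht).2.1]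
  have hL0 : MeasurableSet (firstHit u '' Ioo 0 (u x₀)) :=
    measurableSet_Ioo.image_of_measurable_injOn (firstHit_mono u).measurable hinj
  have hae : ∀ᵐ x, DifferentiableAt ℝ u x := by
    filter_upwards [LocallyIntegrable.ae_hasDerivAt_integral hw.locallyIntegrable] with x hx
    rw [show u = fun x => ∫ t in (-1 : ℝ)..x, w t from funext hu]
    exact (hx (-1)).differentiableAt
  set L := firstHit u '' Ioo 0 (u x₀) ∩ {x | DifferentiableAt ℝ u x} with hLdef
  have hLm : MeasurableSet L := hL0.inter (measurableSet_of_differentiableAt ℝ u)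
  refine ⟨L, hLm, ?_, ?_, fun k => ?_⟩
  · rintro _ ⟨⟨t, ht, rfl⟩, -⟩
    exact Ioo_subset_Icc_self (hspec t ht).1
  · rintro _ ⟨⟨t, ht, rfl⟩, -⟩ y hy
    rw [(hspec t ht).2.1]
    exact (hspec t ht).2.2 y hy
  · have hinj' : InjOn u L := by
      rintro _ ⟨⟨s, hs, rfl⟩, -⟩ _ ⟨⟨t, ht, rfl⟩, -⟩ hst
      rw [(hspec s hs).2.1, (hspec t ht).2.1] at hst
      rw [hst]
    have hcv := lintegral_image_eq_lintegral_abs_deriv_mul hLm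
      (fun x hx => hx.2.hasDerivAt.hasDerivWithinAt) hinj' (fun t => k (firstHit u t) t)
    have hr : ∫⁻ x in L, ENNReal.ofReal |deriv u x| * k x (u x)
        = ∫⁻ t in u '' L, k (firstHit u t) t := by
      rw [hcv]
      refine setLIntegral_congr_fun hLm ?_
      rintro _ ⟨⟨t, ht, rfl⟩, -⟩
      simp only [(hspec t ht).2.1]
    rw [hr]
    refine lintegral_mono' (Measure.restrict_mono_ae ?_) le_rfl
    have hnull : volume (u '' {x | ¬ DifferentiableAt ℝ u x}) = 0 :=
      volume_image_eq_zero_of_primitive hw hu hae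
    have hn : ∀ᵐ t, t ∉ u '' {x | ¬ DifferentiableAt ℝ u x} := measure_eq_zero_iff_ae_notMem.1 hnull
    filter_upwards [hn] with t ht htI
    have htI' : t ∈ Ioo 0 (u x₀) := htI
    refine ⟨firstHit u t, ⟨⟨t, htI', rfl⟩, ?_⟩, (hspec t htI').2.1⟩
    by_contra hnd
    exact ht ⟨firstHit u t, hnd, (hspec t htI').2.1⟩

theorem lintegral_weighted_deriv_srear_le {u : ℝ → ℝ} {M : ℝ}
    (hM : ∀ y ∈ Icc (-1 : ℝ) 1, u y ≤ M) (hM0 : 0 ≤ M) {a : ℝ → ℝ → ℝ} (ha0 : ∀ x v, 0 ≤ a x v)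
    (C : ℝ → ℝ≥0∞) :
    ∫⁻ x in Ioo (0 : ℝ) 1, C (srear u x) * ENNReal.ofReal (a x (srear u x) * |deriv (srear u) x|)
      ≤ ∫⁻ t in Ioo 0 M, C t * ENNReal.ofReal (a (distr u t / 2) t) := by
  have hDm : MeasurableSet {x | deriv (srear u) x ≠ 0} :=
    (measurable_deriv (srear u)) (measurableSet_singleton (0 : ℝ)).compl
  have hinj : InjOn (srear u) (Ioo 0 1 ∩ {x | deriv (srear u) x ≠ 0}) := by
    intro x hx y hy hxy
    have h1 := distr_srear_eq hM hx.1.1 hx.2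
    have h2 := distr_srear_eq hM hy.1.1 hy.2
    rw [hxy] at h1
    linarith
  have hcv := lintegral_image_eq_lintegral_abs_deriv_mul (measurableSet_Ioo.inter hDm)
    (fun x hx => (differentiableAt_of_deriv_ne_zero hx.2).hasDerivAt.hasDerivWithinAt) hinj
    (fun t => C t * ENNReal.ofReal (a (distr u t / 2) t))
  rw [← lintegral_inter_add_sdiff _ (Ioo (0 : ℝ) 1) hDm]
  have hz : ∫⁻ x in Ioo (0 : ℝ) 1 \ {x | deriv (srear u) x ≠ 0},
      C (srear u x) * ENNReal.ofReal (a x (srear u x) * |deriv (srear u) x|) = 0 := by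
    rw [setLIntegral_congr_fun (g := fun _ => 0) (measurableSet_Ioo.diff hDm), lintegral_zero]
    intro x hx
    have : deriv (srear u) x = 0 := by simpa using hx.2
    simp [this]
  have he : ∫⁻ x in Ioo (0 : ℝ) 1 ∩ {x | deriv (srear u) x ≠ 0},
      C (srear u x) * ENNReal.ofReal (a x (srear u x) * |deriv (srear u) x|)
      = ∫⁻ t in srear u '' (Ioo 0 1 ∩ {x | deriv (srear u) x ≠ 0}),
        C t * ENNReal.ofReal (a (distr u t / 2) t) := by
    rw [hcv]
    refine setLIntegral_congr_fun (measurableSet_Ioo.inter hDm) fun x hx => ?_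
    rw [distr_srear_eq hM hx.1.1 hx.2, mul_div_cancel_left₀ _ two_ne_zero,
      ENNReal.ofReal_mul (ha0 _ _)]
    ring
  rw [hz, he, add_zero, setLIntegral_congr Ioo_ae_eq_Icc]
  refine lintegral_mono_set ?_
  rintro _ ⟨x, hx, rfl⟩
  exact ⟨srear_nonneg u x, srear_le hM hM0 hx.1.1⟩

theorem lintegral_weighted_deriv_le {w u : ℝ → ℝ} (hw : Integrable w)
    (hu : ∀ x, u x = ∫ t in (-1 : ℝ)..x, w t) (huc : Continuous u)
    (h0 : ∀ x ∉ Ioo (-1 : ℝ) 1, u x = 0) (x₀ : ℝ) {a : ℝ → ℝ → ℝ}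
    (hac : Continuous fun p : ℝ × ℝ => a p.1 p.2) (ha0 : ∀ x v, 0 ≤ a x v)
    (hsum : ∀ l ρ r v, -1 ≤ l → ρ ≤ 1 → 0 ≤ r → 2 * r ≤ ρ - l → 2 * a r v ≤ a l v + a ρ v)
    {C : ℝ → ℝ≥0∞} (hC : Measurable C) :
    2 * ∫⁻ t in Ioo 0 (u x₀), C t * ENNReal.ofReal (a (distr u t / 2) t)
      ≤ ∫⁻ x in Icc (-1 : ℝ) 1, C (u x) * ENNReal.ofReal (a x (u x) * |deriv u x|) := by
  have hu1 : u 1 = 0 := h0 1 (by simp)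
  set un : ℝ → ℝ := fun x => u (-x) with hun
  have hunc : Continuous un := huc.comp continuous_neg
  have hn0 : ∀ x ∉ Ioo (-1 : ℝ) 1, un x = 0 := fun x hx =>
    h0 _ fun h => hx ⟨by linarith [h.2], by linarith [h.1]⟩
  have hunp : ∀ x, un x = ∫ t in (-1 : ℝ)..x, -w (-t) := by
    intro x
    have h1 := hu 1
    have h2 : (∫ t in (-1 : ℝ)..1, w t) - (∫ t in (-1 : ℝ)..(-x), w t) = ∫ t in (-x)..1, w t :=
      intervalIntegral.integral_interval_sub_left hw.intervalIntegrable hw.intervalIntegrable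
    rw [intervalIntegral.integral_neg, intervalIntegral.integral_comp_neg, neg_neg, ← h2, hun]
    simp only
    rw [hu (-x), ← h1, hu1]
    ring
  obtain ⟨L, hLm, hLs, hLrec, hL⟩ := exists_records hw hu huc h0 x₀
  obtain ⟨R', hRm', hRs', hRrec', hR'⟩ :=
    exists_records (w := fun t => -w (-t)) hw.comp_neg.neg hunp hunc hn0 (-x₀)
  have hM : un (-x₀) = u x₀ := by simp [hun]
  set R : Set ℝ := Neg.neg ⁻¹' R' with hRdef
  have hRm : MeasurableSet R := measurable_neg hRm'
  have hRs : R ⊆ Icc (-1) 1 := fun x hx => by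
    have := hRs' hx
    exact ⟨by linarith [this.2], by linarith [this.1]⟩
  have hR : ∀ k : ℝ → ℝ → ℝ≥0∞, ∫⁻ t in Ioo 0 (u x₀), k (-firstHit un t) t
        ≤ ∫⁻ x in R, ENNReal.ofReal |deriv u x| * k x (u x) := by
    intro k
    have h1 := hR' fun x t => k (-x) t
    rw [hM] at h1
    refine h1.trans (le_of_eq ?_)
    rw [← setLIntegral_comp_neg _ R, hRdef, ← preimage_comp, neg_comp_neg, preimage_id]
    simp only [hun, deriv_comp_neg, abs_neg]
  have hLR : (L ∩ R).Subsingleton := by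
    have key : ∀ x ∈ L ∩ R, ∀ y ∈ L ∩ R, ¬ x < y := by
      intro x hx y hy hxy
      have h1 := hLrec y hy.1 x ⟨(hLs hx.1).1, hxy⟩
      have h2 := hRrec' (-x) hx.2 (-y) ⟨by linarith [(hLs hy.1).2], by linarith⟩
      simp only [hun, neg_neg] at h2
      linarith
    exact fun x hx y hy => le_antisymm (not_lt.1 (key y hy x hx)) (not_lt.1 (key x hx y hy))
  have hdisj : AEDisjoint volume L R := hLR.measure_zero volume
  set k : ℝ → ℝ → ℝ≥0∞ := fun x t => C t * ENNReal.ofReal (a x t) with hk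
  have hkm : ∀ φ : ℝ → ℝ, Measurable φ → Measurable fun t => k (φ t) t := fun φ hφ =>
    hC.mul (hac.measurable.comp (hφ.prodMk measurable_id)).ennreal_ofReal
  calc 2 * ∫⁻ t in Ioo 0 (u x₀), C t * ENNReal.ofReal (a (distr u t / 2) t)
      = ∫⁻ t in Ioo 0 (u x₀), 2 * (C t * ENNReal.ofReal (a (distr u t / 2) t)) :=
        (lintegral_const_mul _
          (hkm (fun t => distr u t / 2) ((distr_antitone u).measurable.div_const 2))).symm
    _ ≤ ∫⁻ t in Ioo 0 (u x₀), (k (firstHit u t) t + k (-firstHit un t) t) := by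
        refine setLIntegral_mono' measurableSet_Ioo fun t ht => ?_
        have h1 := firstHit_spec huc h0 ht.1 ht.2.le
        have h2 := firstHit_spec hunc hn0 ht.1 (hM.symm ▸ ht.2.le : t ≤ un (-x₀))
        have h3 : firstHit u t ≤ -firstHit un t := firstHit_le
          ⟨by linarith [h2.1.2], by linarith [h2.1.1]⟩ h2.2.1.ge
        have h4 : distr u t ≤ -firstHit un t - firstHit u t := by
          refine distr_le_of_subset h3 fun y hy hty => ⟨firstHit_le hy hty.le, ?_⟩
          have := firstHit_le (u := un) (t := t) (y := -y)
            ⟨by linarith [hy.2], by linarith [hy.1]⟩ (by simpa [hun] using hty.le)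
          linarith
        have h5 := hsum (firstHit u t) (-firstHit un t) (distr u t / 2) t h1.1.1.le
          (by linarith [h2.1.1]) (by linarith [distr_nonneg u t]) (by linarith)
        simp only [hk]
        rw [← mul_add, mul_left_comm, ← ENNReal.ofReal_add (ha0 _ _) (ha0 _ _)]
        gcongr
        rw [← ENNReal.ofReal_ofNat, ← ENNReal.ofReal_mul (by norm_num)]
        exact ENNReal.ofReal_le_ofReal h5
    _ = (∫⁻ t in Ioo 0 (u x₀), k (firstHit u t) t)
          + ∫⁻ t in Ioo 0 (u x₀), k (-firstHit un t) t :=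
        lintegral_add_left (hkm _ (firstHit_mono u).measurable) _
    _ ≤ (∫⁻ x in L, ENNReal.ofReal |deriv u x| * k x (u x))
          + ∫⁻ x in R, ENNReal.ofReal |deriv u x| * k x (u x) := add_le_add (hL k) (hR k)
    _ = ∫⁻ x in L ∪ R, ENNReal.ofReal |deriv u x| * k x (u x) := by
        rw [Measure.restrict_union₀ hdisj hRm.nullMeasurableSet, lintegral_add_measure]
    _ ≤ ∫⁻ x in Icc (-1 : ℝ) 1, ENNReal.ofReal |deriv u x| * k x (u x) :=
        lintegral_mono_set (union_subset hLs hRs)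
    _ = _ := by
        refine lintegral_congr fun x => ?_
        rw [ENNReal.ofReal_mul (ha0 _ _), hk]
        ring

/-- The right derivative (a subgradient) of `F t` at `p`, for `F t` convex. -/
def subgrad (F : ℝ → ℝ → ℝ) (t p : ℝ) : ℝ :=
  ⨅ n : ℕ, ((n : ℝ) + 1) * (F t (p + 1 / ((n : ℝ) + 1)) - F t p)

section subgrad

variable {F : ℝ → ℝ → ℝ}

theorem measurable_subgrad (hF : Continuous fun p : ℝ × ℝ => F p.1 p.2) {P : ℝ → ℝ}
    (hP : Measurable P) : Measurable fun t => subgrad F t (P t) := by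
  refine Measurable.iInf fun n => measurable_const.mul (Measurable.sub ?_ ?_)
  · exact hF.measurable.comp (measurable_id.prodMk (hP.add_const _))
  · exact hF.measurable.comp (measurable_id.prodMk hP)

theorem subgrad_term_nonneg {t p : ℝ} (hm : MonotoneOn (F t) (Ici 0)) (hp : 0 ≤ p) (n : ℕ) :
    0 ≤ ((n : ℝ) + 1) * (F t (p + 1 / ((n : ℝ) + 1)) - F t p) := by
  have h : (0 : ℝ) < 1 / ((n : ℝ) + 1) := by positivity
  exact mul_nonneg (by positivity) (sub_nonneg.2
    (hm hp (by simp only [mem_Ici]; linarith) (by linarith)))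

theorem subgrad_nonneg {t p : ℝ} (hm : MonotoneOn (F t) (Ici 0)) (hp : 0 ≤ p) :
    0 ≤ subgrad F t p :=
  Real.iInf_nonneg (subgrad_term_nonneg hm hp)

theorem subgrad_le_term {t p : ℝ} (hm : MonotoneOn (F t) (Ici 0)) (hp : 0 ≤ p) (n : ℕ) :
    subgrad F t p ≤ ((n : ℝ) + 1) * (F t (p + 1 / ((n : ℝ) + 1)) - F t p) :=
  ciInf_le ⟨0, by rintro _ ⟨k, rfl⟩; exact subgrad_term_nonneg hm hp k⟩ n

theorem subgrad_ineq {t p q : ℝ} (hc : ConvexOn ℝ (Ici 0) (F t)) (hm : MonotoneOn (F t) (Ici 0))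
    (hp : 0 ≤ p) (hq : 0 ≤ q) : F t p + subgrad F t p * q ≤ F t q + subgrad F t p * p := by
  rcases lt_trichotomy q p with h | rfl | h
  · have h1 : (F t p - F t q) / (p - q) ≤ subgrad F t p := by
      refine le_ciInf fun n => ?_
      have hn : (0 : ℝ) < 1 / ((n : ℝ) + 1) := by positivity
      have h2 := hc.slope_mono_adjacent (x := q) (y := p) (z := p + 1 / ((n : ℝ) + 1)) hq
        (by simp only [mem_Ici]; linarith) h (by linarith)
      refine h2.trans (le_of_eq ?_)
      field_simp
      ring
    rw [div_le_iff₀ (by linarith)] at h1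
    linarith
  · exact le_rfl
  · obtain ⟨n, hn⟩ := exists_nat_one_div_lt (sub_pos.2 h)
    have hn0 : (0 : ℝ) < 1 / ((n : ℝ) + 1) := by positivity
    have h2 := hc.secant_mono (a := p) (x := p + 1 / ((n : ℝ) + 1)) (y := q) hp
      (by simp only [mem_Ici]; linarith) hq (by linarith) (by linarith) (by linarith)
    have h1 : subgrad F t p ≤ (F t q - F t p) / (q - p) := by
      refine (subgrad_le_term hm hp n).trans (le_trans (le_of_eq ?_) h2)
      field_simp
      ring
    rw [le_div_iff₀ (by linarith)] at h1
    linarith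

end subgrad

/-- The rearrangement inequality for data extended continuously to the whole plane. -/
theorem Ifun_srear_le_of_continuous {w u : ℝ → ℝ} (hw : Integrable w)
    (hu : ∀ x, u x = ∫ t in (-1 : ℝ)..x, w t) (huc : Continuous u)
    (h0 : ∀ x ∉ Ioo (-1 : ℝ) 1, u x = 0) (hnn : ∀ x, 0 ≤ u x) {a F : ℝ → ℝ → ℝ}
    (hac : Continuous fun p : ℝ × ℝ => a p.1 p.2) (ha0 : ∀ x v, 0 ≤ a x v)
    (haeven : ∀ x v, a (-x) v = a x v)
    (hsum : ∀ l ρ r v, -1 ≤ l → ρ ≤ 1 → 0 ≤ r → 2 * r ≤ ρ - l → 2 * a r v ≤ a l v + a ρ v)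
    (hFc : Continuous fun p : ℝ × ℝ => F p.1 p.2) (hF0 : ∀ t p, 0 ≤ F t p)
    (hFconv : ∀ t, ConvexOn ℝ (Ici 0) (F t)) (hFm : ∀ t, MonotoneOn (F t) (Ici 0)) :
    Ifun F a (srear u) ≤ Ifun F a u := by
  obtain ⟨x₀, -, hx₀⟩ := isCompact_Icc.exists_isMaxOn (⟨-1, by simp⟩ : (Icc (-1 : ℝ) 1).Nonempty)
    huc.continuousOn
  have hM : ∀ y ∈ Icc (-1 : ℝ) 1, u y ≤ u x₀ := fun y hy => hx₀ hy
  set v := srear u with hv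
  have hrm : Measurable fun t => distr u t / 2 := (distr_antitone u).measurable.div_const 2
  set p : ℝ → ℝ := fun t => a (distr u t / 2) t * |deriv v (distr u t / 2)| with hp
  have hp0 : ∀ t, 0 ≤ p t := fun t => mul_nonneg (ha0 _ _) (abs_nonneg _)
  have hpm : Measurable p := by
    have h1 : Measurable fun t => deriv v (distr u t / 2) := (measurable_deriv v).comp hrm
    have h2 : Measurable fun t => |deriv v (distr u t / 2)| := continuous_abs.measurable.comp h1
    exact (hac.measurable.comp (hrm.prodMk measurable_id)).mul h2
  have hpv : ∀ x, 0 < x → p (v x) = a x (v x) * |deriv v x| := fun x hx =>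
    abs_deriv_srear hM hx fun y => a y (v x)
  have hcomp : ∀ q : ℝ → ℝ, Measurable q → Measurable fun t => ENNReal.ofReal (F t (q t)) :=
    fun q hq => (hFc.measurable.comp (measurable_id.prodMk hq)).ennreal_ofReal
  have hcompu : ∀ q : ℝ → ℝ, Measurable q →
      Measurable fun x => ENNReal.ofReal (F (u x) (q (u x))) :=
    fun q hq => (hcomp q hq).comp huc.measurable
  have hIv : Ifun F a v = ∫⁻ x in Icc (-1 : ℝ) 1, ENNReal.ofReal (F (u x) (p (u x))) := by
    have hd : ∀ x, |deriv v (-x)| = |deriv v x| := by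
      intro x
      have h1 : deriv (fun y => v (-y)) x = -deriv v (-x) := deriv_comp_neg v x
      rw [show (fun y => v (-y)) = v from funext (srear_neg u)] at h1
      rw [h1, abs_neg]
    rw [Ifun, setLIntegral_Icc_of_even fun x => by rw [hd, hv, srear_neg, haeven],
      lintegral_comp_srear huc hnn hM (hcomp p hpm)]
    congr 1
    exact setLIntegral_congr_fun measurableSet_Ioo fun x hx => by rw [← hv, hpv x hx.1]
  set P : ℕ → ℝ → ℝ := fun n t => min (p t) n with hP
  have hPm : ∀ n, Measurable (P n) := fun n => hpm.min measurable_const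
  have hP0 : ∀ n t, 0 ≤ P n t := fun n t => le_min (hp0 t) n.cast_nonneg
  have hsup : ∀ t, ENNReal.ofReal (F t (p t)) = ⨆ n, ENNReal.ofReal (F t (P n t)) := by
    intro t
    refine le_antisymm ?_ (iSup_le fun n => ENNReal.ofReal_le_ofReal
      (hFm t (hP0 n t) (hp0 t) (min_le_left _ _)))
    obtain ⟨n, hn⟩ := exists_nat_ge (p t)
    refine le_iSup_of_le n ?_
    simp only [hP, min_eq_left hn, le_refl]
  rw [hIv]
  simp_rw [hsup]
  rw [lintegral_iSup (fun n => hcompu _ (hPm n)) fun n k hnk x =>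
    ENNReal.ofReal_le_ofReal (hFm _ (hP0 n _) (hP0 k _)
      (min_le_min_left _ (Nat.cast_le.2 hnk)))]
  refine iSup_le fun n => ?_
  set c : ℝ → ℝ := fun t => subgrad F t (P n t) with hc
  have hc0 : ∀ t, 0 ≤ c t := fun t => subgrad_nonneg (hFm t) (hP0 n t)
  have hcm : Measurable c := measurable_subgrad hFc (hPm n)
  have hem : Measurable fun t => ENNReal.ofReal (c t) * ENNReal.ofReal (P n t) :=
    hcm.ennreal_ofReal.mul (hPm n).ennreal_ofReal
  have hemu : Measurable fun x => ENNReal.ofReal (c (u x)) * ENNReal.ofReal (P n (u x)) :=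
    hem.comp huc.measurable
  have hyoung : (∫⁻ x in Icc (-1 : ℝ) 1, ENNReal.ofReal (F (u x) (P n (u x))))
      + ∫⁻ x in Icc (-1 : ℝ) 1, ENNReal.ofReal (c (u x)) * ENNReal.ofReal (a x (u x) * |deriv u x|)
      ≤ Ifun F a u
        + ∫⁻ x in Icc (-1 : ℝ) 1, ENNReal.ofReal (c (u x)) * ENNReal.ofReal (P n (u x)) := by
    rw [Ifun, ← lintegral_add_left (hcompu _ (hPm n)),
      ← lintegral_add_right _ hemu]
    refine lintegral_mono fun x => ?_
    have hq : 0 ≤ a x (u x) * |deriv u x| := mul_nonneg (ha0 _ _) (abs_nonneg _)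
    rw [← ENNReal.ofReal_mul (hc0 _), ← ENNReal.ofReal_mul (hc0 _),
      ← ENNReal.ofReal_add (hF0 _ _) (mul_nonneg (hc0 _) hq),
      ← ENNReal.ofReal_add (hF0 _ _) (mul_nonneg (hc0 _) (hP0 n _))]
    exact ENNReal.ofReal_le_ofReal (subgrad_ineq (hFconv _) (hFm _) (hP0 n _) hq)
  have hcompare : ∫⁻ x in Icc (-1 : ℝ) 1, ENNReal.ofReal (c (u x)) * ENNReal.ofReal (P n (u x))
      ≤ ∫⁻ x in Icc (-1 : ℝ) 1,
        ENNReal.ofReal (c (u x)) * ENNReal.ofReal (a x (u x) * |deriv u x|) := by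
    rw [lintegral_comp_srear huc hnn hM hem]
    refine le_trans ?_ (lintegral_weighted_deriv_le hw hu huc h0 x₀ hac ha0 hsum
      hcm.ennreal_ofReal)
    refine mul_le_mul_right (le_trans ?_ (lintegral_weighted_deriv_srear_le hM (hnn x₀) ha0
      fun t => ENNReal.ofReal (c t))) 2
    refine setLIntegral_mono' measurableSet_Ioo fun x hx => ?_
    rw [← hv, ← hpv x hx.1]
    gcongr
    exact min_le_left _ _
  have hfin : ∫⁻ x in Icc (-1 : ℝ) 1, ENNReal.ofReal (c (u x)) * ENNReal.ofReal (P n (u x))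
      ≠ ∞ := by
    have hcont : Continuous fun x => (F (u x) (n + 1) * n).toNNReal :=
      continuous_real_toNNReal.comp
        ((hFc.comp (huc.prodMk continuous_const)).mul continuous_const)
    refine ne_top_of_le_ne_top (setLIntegral_lt_top_of_isCompact measure_Icc_lt_top.ne
      isCompact_Icc hcont).ne (lintegral_mono fun x => ?_)
    rw [← ENNReal.ofReal_mul (hc0 _)]
    refine ENNReal.ofReal_le_ofReal
      (mul_le_mul ?_ (min_le_right _ _) (hP0 n _) (hF0 _ _))
    have h1 := subgrad_le_term (hFm (u x)) (hP0 n (u x)) 0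
    have h2 : F (u x) (P n (u x) + 1) ≤ F (u x) (n + 1) := by
      have h3 : P n (u x) ≤ n := min_le_right _ _
      have h4 := hP0 n (u x)
      refine hFm _ ?_ ?_ (by linarith) <;> simp only [mem_Ici] <;> linarith
    have h3 := hF0 (u x) (P n (u x))
    simp only [hc]
    norm_num at h1
    linarith
  exact (ENNReal.add_le_add_iff_right hfin).1 ((add_le_add_right hcompare _).trans hyoung)

/-- `I(a,ū) ≤ I(a,u)` for nonnegative `u ∈ W¹₁(-1,1)` with `u(-1) = u(1) = 0`,
for a continuous weight even and convex in the first argument. -/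
theorem stmt19 (a F : ℝ → ℝ → ℝ) (ha : Weight a) (hF : MemFrakF F)
    (hsym : ∀ v : ℝ, 0 ≤ v → (∀ x ∈ Icc (-1 : ℝ) 1, a (-x) v = a x v) ∧
      ConvexOn ℝ (Icc (-1 : ℝ) 1) (fun x => a x v))
    (u : ℝ → ℝ) (hu : MemW11 u) (hnn : ∀ x ∈ Icc (-1 : ℝ) 1, 0 ≤ u x)
    (hpin : u (-1) = 0) (hpin' : u 1 = 0) :
    Ifun F a (srear u) ≤ Ifun F a u := by
  obtain ⟨hui, huf⟩ := hu
  obtain ⟨hac, ha0⟩ := ha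
  obtain ⟨hFc, hF0, hFconv, hFm⟩ := hF
  set κ : ℝ → ℝ := fun x => max (-1) (min 1 x) with hκ
  have hκc : Continuous κ := by fun_prop
  have hκm : ∀ x, κ x ∈ Icc (-1 : ℝ) 1 := fun x =>
    ⟨le_max_left _ _, max_le (by norm_num) (min_le_left _ _)⟩
  have hκe : ∀ x ∈ Icc (-1 : ℝ) 1, κ x = x := fun x hx => by
    simp only [hκ, min_eq_right hx.2, max_eq_right hx.1]
  have hκn : ∀ x, κ (-x) = -κ x := by
    intro x
    simp only [hκ]
    rcases le_total x (-1) with h | h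
    · rw [min_eq_left (by linarith), min_eq_right (by linarith), max_eq_left h]
      norm_num
    rcases le_total x 1 with h' | h'
    · rw [min_eq_right (by linarith), min_eq_right h', max_eq_right h, max_eq_right (by linarith)]
    · rw [min_eq_right (by linarith), min_eq_left h', max_eq_left (by linarith)]
      norm_num
  set a' : ℝ → ℝ → ℝ := fun x v => a (κ x) (max v 0) with ha'
  set F' : ℝ → ℝ → ℝ := fun t p => F (max t 0) (max p 0) with hF'
  have hmax : ∀ t : ℝ, 0 ≤ max t 0 := fun t => le_max_right _ _
  have hF'e : ∀ t, EqOn (F (max t 0)) (F' t) (Ici 0) := fun t p hp => by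
    simp only [hF', max_eq_left (show (0 : ℝ) ≤ p from hp)]
  have heq : ∀ x ∈ Icc (-1 : ℝ) 1, ∀ t d : ℝ, 0 ≤ t → F t (a x t * |d|) = F' t (a' x t * |d|) := by
    intro x hx t d ht
    have : 0 ≤ a x t * |d| := mul_nonneg (ha0 x t hx ht) (abs_nonneg _)
    simp only [hF', ha', hκe x hx, max_eq_left ht, max_eq_left this]
  set w : ℝ → ℝ := (Icc (-1 : ℝ) 1).indicator (deriv u) with hw
  have hwi : Integrable w := hui.integrable_indicator measurableSet_Icc
  set U : ℝ → ℝ := fun x => ∫ t in (-1 : ℝ)..x, w t with hU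
  have hUc : Continuous U :=
    intervalIntegral.continuous_primitive (fun _ _ => hwi.intervalIntegrable) _
  have hUe : ∀ x ∈ Icc (-1 : ℝ) 1, U x = u x := by
    intro x hx
    rw [huf x hx, hpin, zero_add]
    refine intervalIntegral.integral_congr fun t ht => ?_
    rw [uIcc_of_le hx.1] at ht
    exact indicator_of_mem (s := Icc (-1 : ℝ) 1) ⟨ht.1, ht.2.trans hx.2⟩ (deriv u)
  have hU0 : ∀ x ∉ Ioo (-1 : ℝ) 1, U x = 0 := by
    intro x hx
    rcases le_or_gt x (-1) with h | h
    · have h1 : ∫ t in x..(-1 : ℝ), w t = 0 := by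
        rw [intervalIntegral.integral_of_le h, integral_Ioc_eq_integral_Ioo]
        refine setIntegral_eq_zero_of_forall_eq_zero fun t ht => ?_
        exact indicator_of_notMem (fun h' => not_le.2 ht.2 h'.1) _
      rw [hU]
      simp only
      rw [intervalIntegral.integral_symm, h1, neg_zero]
    · have h1x : 1 ≤ x := by
        by_contra! h'
        exact hx ⟨h, h'⟩
      have h1 : ∫ t in (1 : ℝ)..x, w t = 0 := by
        rw [intervalIntegral.integral_of_le h1x]
        refine setIntegral_eq_zero_of_forall_eq_zero fun t ht => ?_
        exact indicator_of_notMem (fun h' => not_le.2 ht.1 h'.2) _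
      have h2 := intervalIntegral.integral_add_adjacent_intervals
        (hwi.intervalIntegrable (a := -1) (b := 1)) (hwi.intervalIntegrable (a := 1) (b := x))
      have h3 : ∫ t in (-1 : ℝ)..1, w t = 0 := (hUe 1 (by simp)).trans hpin'
      rw [h1, h3, add_zero] at h2
      exact h2.symm
  have hUnn : ∀ x, 0 ≤ U x := by
    intro x
    by_cases hx : x ∈ Ioo (-1 : ℝ) 1
    · rw [hUe x (Ioo_subset_Icc_self hx)]
      exact hnn x (Ioo_subset_Icc_self hx)
    · rw [hU0 x hx]
  have hsr : srear u = srear U := by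
    have hset : ∀ t, {y ∈ Icc (-1 : ℝ) 1 | u y > t} = {y ∈ Icc (-1 : ℝ) 1 | U y > t} := by
      intro t
      ext y
      exact and_congr_right fun hy => by rw [hUe y hy]
    funext x
    simp only [srear, hset]
  have hleft : Ifun F a (srear u) = Ifun F' a' (srear U) := by
    rw [hsr]
    exact setLIntegral_congr_fun measurableSet_Icc fun x hx => by
      simp only [heq x hx _ _ (srear_nonneg U x)]
  have hright : Ifun F a u = Ifun F' a' U := by
    simp only [Ifun]
    rw [setLIntegral_congr Ioo_ae_eq_Icc.symm, setLIntegral_congr Ioo_ae_eq_Icc.symm]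
    refine setLIntegral_congr_fun measurableSet_Ioo fun x hx => ?_
    have hd : deriv U x = deriv u x := Filter.EventuallyEq.deriv_eq
      (eventually_of_mem (Ioo_mem_nhds hx.1 hx.2) fun y hy => hUe y (Ioo_subset_Icc_self hy))
    have hx' := Ioo_subset_Icc_self hx
    simp only [hd, hUe x hx', heq x hx' _ _ (hnn x hx')]
  rw [hleft, hright]
  refine Ifun_srear_le_of_continuous hwi (fun _ => rfl) hUc hU0 hUnn ?_ ?_ ?_ ?_ ?_ ?_ ?_ ?_
  · exact hac.comp_continuous (f := fun p : ℝ × ℝ => (κ p.1, max p.2 0))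
      ((hκc.comp continuous_fst).prodMk (continuous_snd.max continuous_const))
      fun p => ⟨hκm _, hmax _⟩
  · exact fun x v => ha0 _ _ (hκm x) (hmax v)
  · intro x v
    simp only [ha', hκn]
    exact (hsym _ (hmax v)).1 _ (hκm x)
  · intro l ρ r v hl hρ hr hlr
    obtain ⟨hev, hcv⟩ := hsym _ (hmax v)
    have hl' : l ∈ Icc (-1 : ℝ) 1 := ⟨hl, by linarith⟩
    have hl'' : -l ∈ Icc (-1 : ℝ) 1 := ⟨by linarith, by linarith⟩
    have hρ' : ρ ∈ Icc (-1 : ℝ) 1 := ⟨by linarith, hρ⟩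
    have hr' : r ∈ Icc (-1 : ℝ) 1 := ⟨by linarith, by linarith⟩
    have hs : (ρ - l) / 2 ∈ Icc (-1 : ℝ) 1 := ⟨by linarith, by linarith⟩
    have hs' : -((ρ - l) / 2) ∈ Icc (-1 : ℝ) 1 := ⟨by linarith, by linarith⟩
    simp only [ha', hκe _ hl', hκe _ hρ', hκe _ hr']
    have h1 := hcv.le_max_of_mem_Icc hs' hs (z := r) ⟨by linarith, by linarith⟩
    simp only [hev _ hs, max_self] at h1
    have h2 := hcv.2 hl'' hρ' (show (0 : ℝ) ≤ 1 / 2 by norm_num)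
      (show (0 : ℝ) ≤ 1 / 2 by norm_num) (by norm_num)
    simp only [smul_eq_mul, hev _ hl'] at h2
    rw [show (1 / 2 : ℝ) * -l + 1 / 2 * ρ = (ρ - l) / 2 by ring] at h2
    linarith
  · exact hFc.comp_continuous (f := fun p : ℝ × ℝ => (max p.1 0, max p.2 0))
      ((continuous_fst.max continuous_const).prodMk (continuous_snd.max continuous_const))
      fun p => ⟨hmax _, hmax _⟩
  · exact fun t p => hF0 _ _ (hmax t) (hmax p)
  · exact fun t => (hFconv _ (hmax t)).congr (hF'e t)
  · exact fun t => (hFm _ (hmax t)).congr (hF'e t)
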